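/- For all real (or formal power series) x, the generating function identity holds: -(1/2) * log((exp(x/2) - exp(-x/2))/x) = -∑_{k≥1} (B_{2k} / (4k * (2k)!)) * x^{2k}, where B_{2k} are the Bernoulli numbers. -/

import Mathlib

theorem hasDerivAt_exp_half_sub_exp_neg_half (x : ℝ) :
    HasDerivAt (fun y : ℝ => Real.exp (y / 2) - Real.exp (-y / 2))
      ((Real.exp (x / 2) + Real.exp (-x / 2)) / 2) x := by
  refine HasDerivAt.congr_deriv ((((hasDerivAt_id' x).div_const 2).exp).fun_sub
    (((hasDerivAt_id' x).fun_neg.div_const 2).exp)) ?_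
  ring

open Filter Topology in
theorem tendsto_exp_half_sub_exp_neg_half_div :
    Tendsto (fun y : ℝ => (Real.exp (y / 2) - Real.exp (-y / 2)) / y) (𝓝[>] 0) (𝓝 1) := by
  have h1 : HasDerivAt (fun y : ℝ => Real.exp (y / 2) - Real.exp (-y / 2)) 1 0 :=
    (hasDerivAt_exp_half_sub_exp_neg_half 0).congr_deriv (by norm_num)
  have h2 := h1.tendsto_slope.mono_left (nhdsWithin_mono 0 fun y (hy : 0 < y) => hy.ne')
  refine h2.congr fun y => ?_
  simp [slope_def_field]

theorem abs_bernoulli_div_factorial_le_one (n : ℕ) :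
    |(bernoulli n : ℝ) / (n.factorial : ℝ)| ≤ 1 := by
  rcases Nat.even_or_odd' n with ⟨k, rfl | rfl⟩
  · rcases eq_or_ne k 0 with rfl | hk
    · simp
    · have h := hasSum_zeta_nat hk
      have h2 := hasSum_zeta_two
      have hle := hasSum_le (fun i : ℕ => by
        rcases eq_or_ne i 0 with rfl | hi
        · simp [hk]
        · have h1 : (1 : ℝ) ≤ i := by exact_mod_cast Nat.one_le_iff_ne_zero.mpr hi
          exact one_div_le_one_div_of_le (by positivity) (pow_le_pow_right₀ h1 (by lia))) h h2
      have hnn := h.nonneg fun i => by positivity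
      rw [← abs_of_nonneg hnn] at hle
      have hpi : (Real.pi ^ 2 : ℝ) ≤ Real.pi ^ (2 * k) :=
        pow_le_pow_right₀ (by linarith [Real.pi_gt_three]) (by lia)
      have h2k : (2 : ℝ) ≤ 2 ^ (2 * k - 1) := le_self_pow₀ (by norm_num) (by lia)
      have heq : (-1 : ℝ) ^ (k + 1) * 2 ^ (2 * k - 1) * Real.pi ^ (2 * k) * bernoulli (2 * k) /
          (2 * k).factorial = (-1 : ℝ) ^ (k + 1) * (2 ^ (2 * k - 1) * Real.pi ^ (2 * k)) *
          (bernoulli (2 * k) / (2 * k).factorial) := by ring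
      rw [heq, abs_mul, abs_mul, abs_neg_one_pow, one_mul,
        abs_of_pos (show (0 : ℝ) < 2 ^ (2 * k - 1) * Real.pi ^ (2 * k) by positivity)] at hle
      have hpos : (0 : ℝ) < Real.pi ^ 2 := by positivity
      have hbig : (Real.pi ^ 2 : ℝ) ≤ 2 ^ (2 * k - 1) * Real.pi ^ (2 * k) := by nlinarith
      by_contra! hlt
      nlinarith
  · rcases eq_or_ne k 0 with rfl | hk
    · norm_num [bernoulli_one, abs_le]
    · rw [bernoulli_eq_zero_of_odd ⟨k, rfl⟩ (by lia)]
      simp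

theorem hasSum_bernoulli_div_factorial_mul_pow {x : ℝ} (hx : x ≠ 0) (hx1 : |x| < 1) :
    HasSum (fun n : ℕ => (bernoulli n : ℝ) / n.factorial * x ^ n) (x / (Real.exp x - 1)) := by
  have hb : Summable fun n : ℕ => ‖(bernoulli n : ℝ) / n.factorial * x ^ n‖ := by
    refine (summable_geometric_of_lt_one (abs_nonneg x) hx1).of_nonneg_of_le
      (fun _ => norm_nonneg _) fun n => ?_
    rw [norm_mul, norm_pow, Real.norm_eq_abs, Real.norm_eq_abs]
    exact mul_le_of_le_one_left (by positivity) (abs_bernoulli_div_factorial_le_one n)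
  have he : HasSum (fun n : ℕ => PowerSeries.coeff n (PowerSeries.exp ℝ - 1) * x ^ n)
      (Real.exp x - 1) := by
    have h := (NormedSpace.expSeries_div_hasSum_exp x).sub (hasSum_ite_eq (0 : ℕ) (1 : ℝ))
    rw [← Real.exp_eq_exp_ℝ] at h
    refine h.congr_fun fun n => ?_
    rcases eq_or_ne n 0 with rfl | hn
    · simp
    · simp [PowerSeries.coeff_exp, PowerSeries.coeff_one, hn, div_eq_inv_mul]
  have hne : Real.exp x - 1 ≠ 0 := sub_ne_zero.mpr (by simpa using hx)
  have hprod := tsum_mul_tsum_eq_tsum_sum_antidiagonal_of_summable_norm hb he.summable.norm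
  have hcoeff (n : ℕ) : ∑ p ∈ Finset.HasAntidiagonal.antidiagonal n,
      ((bernoulli p.1 : ℝ) / p.1.factorial * x ^ p.1) *
        (PowerSeries.coeff p.2 (PowerSeries.exp ℝ - 1) * x ^ p.2) =
      if n = 1 then x else 0 := by
    have h := congrArg (PowerSeries.coeff n) (bernoulliPowerSeries_mul_exp_sub_one ℝ)
    rw [PowerSeries.coeff_mul, PowerSeries.coeff_X] at h
    calc _ = (∑ p ∈ Finset.HasAntidiagonal.antidiagonal n,
          PowerSeries.coeff p.1 (bernoulliPowerSeries ℝ) *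
          PowerSeries.coeff p.2 (PowerSeries.exp ℝ - 1)) * x ^ n := by
          rw [Finset.sum_mul]
          refine Finset.sum_congr rfl fun p hp => ?_
          rw [← Finset.HasAntidiagonal.mem_antidiagonal.mp hp, pow_add]
          simp only [bernoulliPowerSeries, PowerSeries.coeff_mk, eq_ratCast, Rat.cast_div,
            Rat.cast_natCast]
          ring
      _ = _ := by
          rw [h]
          split_ifs with hn <;> simp [hn]
  simp_rw [hcoeff, tsum_ite_eq, he.tsum_eq] at hprod
  rw [← eq_div_of_mul_eq hne hprod]
  exact hb.of_norm.hasSum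

theorem hasSum_even_bernoulli_div_factorial_mul_pow {x : ℝ} (hx : x ≠ 0) (hx1 : |x| < 1) :
    HasSum (fun k : ℕ => (bernoulli (2 * (k + 1)) : ℝ) / (2 * (k + 1)).factorial * x ^ (2 * k + 1))
      (1 / (Real.exp x - 1) + 1 / 2 - 1 / x) := by
  have h := (hasSum_nat_add_iff' 2).mpr (hasSum_bernoulli_div_factorial_mul_pow hx hx1)
  have hinj : Function.Injective fun k : ℕ => 2 * k := fun a b hab => by simpa using hab
  rw [← hinj.hasSum_iff] at h
  · have hval : (x / (Real.exp x - 1) -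
        ∑ i ∈ Finset.range 2, (bernoulli i : ℝ) / i.factorial * x ^ i) / x =
        1 / (Real.exp x - 1) + 1 / 2 - 1 / x := by
      have hne : Real.exp x - 1 ≠ 0 := sub_ne_zero.mpr (by simpa using hx)
      norm_num [Finset.sum_range_succ, bernoulli_zero, bernoulli_one]
      field_simp
      ring
    rw [← hval]
    refine (h.div_const x).congr_fun fun k => ?_
    rw [Function.comp_apply, show 2 * k + 2 = 2 * (k + 1) by ring,
      show 2 * (k + 1) = 2 * k + 1 + 1 by ring, pow_succ x (2 * k + 1)]
    field_simp
  · intro n hn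
    have hodd : Odd n := by
      rw [← Nat.not_even_iff_odd]
      rintro ⟨m, rfl⟩
      exact hn ⟨m, two_mul m⟩
    rw [bernoulli_eq_zero_of_odd (hodd.add_even even_two) (by have := hodd.pos; lia)]
    simp

theorem summable_even_bernoulli_div_mul_pow {x : ℝ} (hx1 : |x| < 1) :
    Summable fun k : ℕ => (bernoulli (2 * (k + 1)) : ℝ) / (2 * (k + 1)).factorial /
      (2 * (k + 1)) * x ^ (2 * (k + 1)) := by
  have hinj : Function.Injective fun k : ℕ => 2 * (k + 1) := fun a b hab => by simpa using hab
  refine Summable.of_norm_bounded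
    ((summable_geometric_of_lt_one (abs_nonneg x) hx1).comp_injective hinj) fun k => ?_
  rw [norm_mul, norm_pow, norm_div, Real.norm_eq_abs, Real.norm_eq_abs, Real.norm_eq_abs]
  refine mul_le_of_le_one_left (by positivity) ?_
  refine div_le_one_of_le₀ ((abs_bernoulli_div_factorial_le_one _).trans ?_) (abs_nonneg _)
  rw [abs_of_nonneg (by positivity)]
  linarith [(Nat.cast_nonneg k : (0 : ℝ) ≤ k)]

theorem hasDerivAt_tsum_even_bernoulli {x : ℝ} (hx1 : |x| < 1) :
    HasDerivAt (fun y : ℝ => ∑' k : ℕ, (bernoulli (2 * (k + 1)) : ℝ) / (2 * (k + 1)).factorial /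
      (2 * (k + 1)) * y ^ (2 * (k + 1)))
      (∑' k : ℕ, (bernoulli (2 * (k + 1)) : ℝ) / (2 * (k + 1)).factorial * x ^ (2 * k + 1)) x := by
  obtain ⟨r, hxr, hr1⟩ := exists_between hx1
  have hr0 : 0 ≤ r := (abs_nonneg x).trans hxr.le
  have hinj : Function.Injective fun k : ℕ => 2 * k + 1 := fun a b hab => by simpa using hab
  refine hasDerivAt_tsum_of_isPreconnected (y₀ := x) (u := fun k => r ^ (2 * k + 1))
    (t := Set.Ioo (-r) r)
    (g := fun k y => (bernoulli (2 * (k + 1)) : ℝ) / (2 * (k + 1)).factorial /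
      (2 * (k + 1)) * y ^ (2 * (k + 1)))
    (g' := fun k y => (bernoulli (2 * (k + 1)) : ℝ) / (2 * (k + 1)).factorial * y ^ (2 * k + 1))
    ((summable_geometric_of_lt_one hr0 hr1).comp_injective hinj)
    isOpen_Ioo isPreconnected_Ioo ?_ ?_ (abs_lt.mp hxr)
    (summable_even_bernoulli_div_mul_pow hx1) (abs_lt.mp hxr)
  · intro k y _
    refine ((hasDerivAt_pow (2 * (k + 1)) y).const_mul
      ((bernoulli (2 * (k + 1)) : ℝ) / (2 * (k + 1)).factorial / (2 * (k + 1)))).congr_deriv ?_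
    rw [show 2 * (k + 1) - 1 = 2 * k + 1 by lia]
    push_cast
    field_simp
  · intro k y hy
    rw [norm_mul, norm_pow, Real.norm_eq_abs, Real.norm_eq_abs]
    calc _ ≤ 1 * |y| ^ (2 * k + 1) := by
          gcongr
          exact abs_bernoulli_div_factorial_le_one _
      _ ≤ r ^ (2 * k + 1) := by
          rw [one_mul]
          exact pow_le_pow_left₀ (abs_nonneg y) (abs_lt.mpr hy).le _

theorem hasDerivAt_log_exp_half_sub_exp_neg_half_div {x : ℝ} (hx : 0 < x) :
    HasDerivAt (fun y : ℝ => Real.log ((Real.exp (y / 2) - Real.exp (-y / 2)) / y))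
      (1 / (Real.exp x - 1) + 1 / 2 - 1 / x) x := by
  have hpos : 0 < Real.exp (x / 2) - Real.exp (-x / 2) :=
    sub_pos.mpr (Real.exp_lt_exp.mpr (by linarith))
  refine (((hasDerivAt_exp_half_sub_exp_neg_half x).fun_div (hasDerivAt_id' x) hx.ne').log
    (div_pos hpos hx).ne').congr_deriv ?_
  symm
  have hexp : Real.exp x = Real.exp (x / 2) ^ 2 := by
    rw [← Real.exp_nat_mul]
    congr 1
    push_cast
    ring
  have hneg : Real.exp (-x / 2) = (Real.exp (x / 2))⁻¹ := by
    rw [← Real.exp_neg]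
    congr 1
    ring
  have h1 : Real.exp (x / 2) ^ 2 - 1 ≠ 0 := by
    rw [← hexp]
    exact sub_ne_zero.mpr (by simpa using hx.ne')
  have h0 := (Real.exp_pos (x / 2)).ne'
  rw [hexp, hneg]
  generalize Real.exp (x / 2) = e at *
  have h2 : e - e⁻¹ ≠ 0 := by
    intro h3
    apply h1
    field_simp at h3
    linarith
  field_simp
  ring

open Filter Topology in
theorem tsum_even_bernoulli_eq_log {x : ℝ} (hx : 0 < x) (hx1 : x < 1) :
    ∑' k : ℕ, (bernoulli (2 * (k + 1)) : ℝ) / (2 * (k + 1)).factorial /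
      (2 * (k + 1)) * x ^ (2 * (k + 1)) =
    Real.log ((Real.exp (x / 2) - Real.exp (-x / 2)) / x) := by
  set F : ℝ → ℝ := fun y => ∑' k : ℕ, (bernoulli (2 * (k + 1)) : ℝ) / (2 * (k + 1)).factorial /
      (2 * (k + 1)) * y ^ (2 * (k + 1))
  set G : ℝ → ℝ := fun y => Real.log ((Real.exp (y / 2) - Real.exp (-y / 2)) / y)
  have hderiv : ∀ y ∈ Set.Ioo (0 : ℝ) 1, HasDerivAt (fun y => F y - G y) 0 y := by
    intro y hy
    have hy1 : |y| < 1 := by rw [abs_of_pos hy.1]; exact hy.2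
    have h := (hasDerivAt_tsum_even_bernoulli hy1).sub
      (hasDerivAt_log_exp_half_sub_exp_neg_half_div hy.1)
    rwa [(hasSum_even_bernoulli_div_factorial_mul_pow hy.1.ne' hy1).tsum_eq, sub_self] at h
  have hconst : ∀ y ∈ Set.Ioo (0 : ℝ) 1, F y - G y = F x - G x := fun y hy =>
    isOpen_Ioo.is_const_of_deriv_eq_zero isPreconnected_Ioo
      (fun z hz => (hderiv z hz).differentiableAt.differentiableWithinAt)
      (fun z hz => (hderiv z hz).deriv) hy ⟨hx, hx1⟩
  have hF0 : Tendsto F (𝓝[>] 0) (𝓝 0) := by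
    have h := (hasDerivAt_tsum_even_bernoulli (x := 0) (by simp)).continuousAt.tendsto
    simpa using h.mono_left nhdsWithin_le_nhds
  have hG0 : Tendsto G (𝓝[>] 0) (𝓝 0) := by
    have h := tendsto_exp_half_sub_exp_neg_half_div.log one_ne_zero
    rwa [Real.log_one] at h
  have hlim : Tendsto (fun y => F y - G y) (𝓝[>] 0) (𝓝 (F x - G x)) :=
    tendsto_const_nhds.congr' <| by
      filter_upwards [Ioo_mem_nhdsGT one_pos] with y hy using (hconst y hy).symm
  have h := tendsto_nhds_unique hlim (hF0.sub hG0)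
  rw [sub_zero] at h
  exact sub_eq_zero.mp h

/-- The generating function identity
`-(1/2) * log((exp(x/2) - exp(-x/2))/x) = -∑_{k≥1} B_{2k}/(4k(2k)!) x^{2k}`
for real `x` in a (punctured) neighborhood of `0`. -/
theorem duflo_function_bernoulli_expansion (x : ℝ) (hx : 0 < |x|) (hx1 : |x| < 1) :
    HasSum
      (fun k : ℕ =>
        -((bernoulli (2 * (k + 1)) : ℝ) / (4 * (k + 1) * (Nat.factorial (2 * (k + 1))))) * x ^ (2 * (k + 1)))
      (-(1 / 2) * Real.log ((Real.exp (x / 2) - Real.exp (-x / 2)) / x)) := by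
  have hlog : Real.log ((Real.exp (x / 2) - Real.exp (-x / 2)) / x) =
      Real.log ((Real.exp (|x| / 2) - Real.exp (-|x| / 2)) / |x|) := by
    rcases abs_choice x with h | h
    · rw [h]
    · rw [h, neg_neg, div_neg, ← neg_div, neg_sub]
  have h := (summable_even_bernoulli_div_mul_pow hx1).hasSum
  have habs (k : ℕ) : x ^ (2 * (k + 1)) = |x| ^ (2 * (k + 1)) :=
    ((even_two_mul _).pow_abs x).symm
  rw [hlog, ← tsum_even_bernoulli_eq_log hx hx1]
  simp_rw [← habs]
  refine (h.mul_left (-(1 / 2))).congr_fun fun k => ?_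
  field_simp
  ring
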